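/- arXiv:1806.00693 — 7 statements merged into one kernel-verified Lean document; each statement's English description precedes it below -/
import Mathlib

section
/- Let (X, f_{1,∞}) be a non-autonomous discrete dynamical system and let F be a filterdual Furstenberg family. landmark claim: (X, f_{1,∞}) is weakly F-sensitive if and only if (X, f_{1,∞}) is F-sensitive. -/
open Set

/-- `orbitN f n = f_1^n = f (n-1) ∘ ⋯ ∘ f 0` (the sequence of maps is 0-indexed). -/
def orbitN {X : Type*} (f : ℕ → X → X) : ℕ → X → X
  | 0 => id
  | n + 1 => f n ∘ orbitN f n

/-- A (proper) Furstenberg family: hereditary upwards, nonempty, and not all of `Set ℕ`. -/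
def IsFurstenbergFamily (F : Set (Set ℕ)) : Prop :=
  (∀ ⦃A B : Set ℕ⦄, A ⊆ B → A ∈ F → B ∈ F) ∧ F.Nonempty ∧ F ≠ Set.univ

/-- The dual family `kF = {A : ℕ \ A ∉ F}`. -/
def dualFam (F : Set (Set ℕ)) : Set (Set ℕ) := {A : Set ℕ | Aᶜ ∉ F}

/-- `F` is filterdual: the dual family `kF` is closed under pairwise intersections. -/
def IsFilterdual (F : Set (Set ℕ)) : Prop :=
  ∀ ⦃A B : Set ℕ⦄, A ∈ dualFam F → B ∈ dualFam F → A ∩ B ∈ dualFam F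

/-- `F` is translation invariant: `A + i ∈ F` and `A - i ∈ F` for all `A ∈ F`, `i ∈ ℕ`. -/
def TransInv (F : Set (Set ℕ)) : Prop :=
  ∀ A ∈ F, ∀ i : ℕ, ((fun n => n + i) '' A) ∈ F ∧ ((fun n => n + i) ⁻¹' A) ∈ F

/-- The NDS `(X, f_{1,∞})` is `F`-sensitive. -/
def FSens {X : Type*} [MetricSpace X] (f : ℕ → X → X) (F : Set (Set ℕ)) : Prop :=
  ∃ δ > (0 : ℝ), ∀ x : X, ∀ U : Set X, IsOpen U → x ∈ U →
    ∃ y ∈ U, {n : ℕ | δ < dist (orbitN f n x) (orbitN f n y)} ∈ F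

/-- The NDS `(X, f_{1,∞})` is weakly `F`-sensitive. -/
def WFSens {X : Type*} [MetricSpace X] (f : ℕ → X → X) (F : Set (Set ℕ)) : Prop :=
  ∃ δ > (0 : ℝ), ∀ U : Set X, IsOpen U → U.Nonempty →
    ∃ x ∈ U, ∃ y ∈ U, {n : ℕ | δ < dist (orbitN f n x) (orbitN f n y)} ∈ F

/-- The `F`-attaching set of `A` for the system `g_{1,∞}`. -/
def attachSet {Z : Type*} (g : ℕ → Z → Z) (F : Set (Set ℕ)) (A : Set Z) : Set Z :=
  {z : Z | {n : ℕ | orbitN g n z ∈ A} ∈ F}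

/-- The product system `f_{1,∞} × f_{1,∞}` on `X × X`. -/
def prodSys {X : Type*} (f : ℕ → X → X) : ℕ → X × X → X × X :=
  fun n p => (f n p.1, f n p.2)

/-- The set of `F`-`δ`-asymptotic pairs `Asym_δ(F)`. -/
def asymSet {X : Type*} [MetricSpace X] (f : ℕ → X → X) (F : Set (Set ℕ)) (δ : ℝ) :
    Set (X × X) :=
  {p : X × X | {n : ℕ | dist (orbitN f n p.1) (orbitN f n p.2) ≤ δ} ∈ dualFam F}

/-- `F` is compatible with the system `(Z, g_{1,∞})`:
the `F`-attaching set of every open set is `Gδ`. -/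
def CompatibleWith {Z : Type*} [TopologicalSpace Z] (g : ℕ → Z → Z) (F : Set (Set ℕ)) : Prop :=
  ∀ U : Set Z, IsOpen U → IsGδ (attachSet g F U)

/-- An `Fσ` set: a countable union of closed sets. -/
def IsFsigmaSet {Z : Type*} [TopologicalSpace Z] (s : Set Z) : Prop :=
  ∃ S : ℕ → Set Z, (∀ n, IsClosed (S n)) ∧ s = ⋃ n, S n

/-- The `k`-th iterate system `f_{1,∞}^{[k]}`: its `n`-th map is
`f_{k(n+1)-1} ∘ ⋯ ∘ f_{kn}` (0-indexed), so that its `n`-fold orbit map is `f_1^{kn}`. -/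
def iterSys {X : Type*} (f : ℕ → X → X) (k : ℕ) : ℕ → X → X :=
  fun n => orbitN (fun i => f (k * n + i)) k

/-- For a filterdual Furstenberg family `F`, the NDS `(X, f_{1,∞})`
is weakly `F`-sensitive iff it is `F`-sensitive. -/
theorem weaklyFSensitive_iff_fSensitive {X : Type*} [MetricSpace X] [CompactSpace X]
    (f : ℕ → X → X) (hf : ∀ n, Continuous (f n))
    (F : Set (Set ℕ)) (hF : IsFurstenbergFamily F) (hFd : IsFilterdual F) :
    WFSens f F ↔ FSens f F := by
  constructor
  · rintro ⟨δ, hδ, h⟩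
    refine ⟨δ / 2, by positivity, fun x U hU hx => ?_⟩
    obtain ⟨y, hy, z, hz, hyz⟩ := h U hU ⟨x, hx⟩
    by_contra hcon
    push Not at hcon
    have h1 := hcon y hy
    have h2 := hcon z hz
    have h3 := @hFd {n : ℕ | δ / 2 < dist (orbitN f n x) (orbitN f n y)}ᶜ
      {n : ℕ | δ / 2 < dist (orbitN f n x) (orbitN f n z)}ᶜ
      (by simpa [dualFam] using h1) (by simpa [dualFam] using h2)
    refine h3 (hF.1 ?_ hyz)
    intro n hn hn'
    simp only [mem_inter_iff, mem_compl_iff, mem_setOf_eq, not_lt] at hn hn'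
    have := dist_triangle_left (orbitN f n y) (orbitN f n z) (orbitN f n x)
    linarith [hn'.1, hn'.2]
  · rintro ⟨δ, hδ, h⟩
    refine ⟨δ, hδ, fun U hU ⟨x, hx⟩ => ?_⟩
    obtain ⟨y, hy, hxy⟩ := h x U hU hx
    exact ⟨x, hx, y, hy, hxy⟩
end

section
/- Let (X, f_{1,∞}) be a non-autonomous discrete dynamical system and let F be a Furstenberg family that is filterdual and compatible with the product system (X × X, f_{1,∞} × f_{1,∞}). Then the following are equivalent: (1) (X, f_{1,∞}) is weakly F-sensitive; (2) there exists δ > 0 such that for every x ∈ X the section Asym_δ(F)(x) is a first category (meagre) subset of X; (3) there exists δ > 0 such that Asym_δ(F) is a first category (meagre) subset of X × X; (4) there exists δ > 0 such that the F-attaching set (with respect to the product system) of X × X \ {(x,y) : d(x,y) ≤ δ} is dense in X × X; (5) (X, f_{1,∞}) is F-sensitive. -/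
open Set

theorem orbitN_prodSys_aux {X : Type*} (f : ℕ → X → X) (n : ℕ) (p : X × X) :
    orbitN (prodSys f) n p = (orbitN f n p.1, orbitN f n p.2) := by
  induction n with
  | zero => rfl
  | succ k ih =>
    show prodSys f k (orbitN (prodSys f) k p) = _
    rw [ih]; rfl

theorem mem_attach_aux {X : Type*} [MetricSpace X] (f : ℕ → X → X) (F : Set (Set ℕ)) (δ : ℝ)
    (p : X × X) : p ∈ attachSet (prodSys f) F {p : X × X | δ < dist p.1 p.2} ↔
      {n : ℕ | δ < dist (orbitN f n p.1) (orbitN f n p.2)} ∈ F := by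
  simp only [attachSet, Set.mem_setOf_eq, orbitN_prodSys_aux]

theorem asym_compl_aux {X : Type*} [MetricSpace X] (f : ℕ → X → X) (F : Set (Set ℕ)) (δ : ℝ) :
    asymSet f F δ = (attachSet (prodSys f) F {p : X × X | δ < dist p.1 p.2})ᶜ := by
  ext p
  rw [Set.mem_compl_iff, mem_attach_aux]
  simp only [asymSet, dualFam, Set.mem_setOf_eq, Set.compl_setOf, not_le]

theorem split_aux {X : Type*} [MetricSpace X] (f : ℕ → X → X) (F : Set (Set ℕ))
    (hF : IsFurstenbergFamily F) (hFd : IsFilterdual F) (δ : ℝ) (x y z : X)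
    (h : {n : ℕ | δ < dist (orbitN f n x) (orbitN f n y)} ∈ F) :
    {n : ℕ | δ / 2 < dist (orbitN f n z) (orbitN f n x)} ∈ F ∨
    {n : ℕ | δ / 2 < dist (orbitN f n z) (orbitN f n y)} ∈ F := by
  by_contra! hc
  have := @hFd {n : ℕ | δ / 2 < dist (orbitN f n z) (orbitN f n x)}ᶜ
    {n : ℕ | δ / 2 < dist (orbitN f n z) (orbitN f n y)}ᶜ
    (by simpa [dualFam] using hc.1) (by simpa [dualFam] using hc.2)
  refine this (hF.1 ?_ h)
  intro n hn
  simp only [Set.mem_compl_iff, Set.mem_inter_iff, Set.mem_setOf_eq] at hn ⊢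
  rintro ⟨h1, h2⟩
  have := dist_triangle_left (orbitN f n x) (orbitN f n y) (orbitN f n z)
  linarith

/-- For a filterdual Furstenberg family `F` compatible with the product
system `(X × X, f_{1,∞} × f_{1,∞})`, the five conditions are equivalent. -/
theorem fSensitive_tfae {X : Type*} [MetricSpace X] [CompactSpace X]
    (f : ℕ → X → X) (hf : ∀ n, Continuous (f n))
    (F : Set (Set ℕ)) (hF : IsFurstenbergFamily F) (hFd : IsFilterdual F)
    (hcompat : CompatibleWith (prodSys f) F) :
    List.TFAE
      [ WFSens f F,
        ∃ δ > (0 : ℝ), ∀ x : X, IsMeagre {y : X | (x, y) ∈ asymSet f F δ},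
        ∃ δ > (0 : ℝ), IsMeagre (asymSet f F δ),
        ∃ δ > (0 : ℝ), Dense (attachSet (prodSys f) F {p : X × X | δ < dist p.1 p.2}),
        FSens f F ] := by
  have hop : ∀ δ : ℝ, IsGδ (attachSet (prodSys f) F {p : X × X | δ < dist p.1 p.2}) :=
    fun δ => hcompat _ (isOpen_lt continuous_const (continuous_fst.dist continuous_snd))
  tfae_have 1 → 5 := by
    rintro ⟨δ, hδ, h⟩
    refine ⟨δ / 2, by linarith, fun z U hU hz => ?_⟩
    obtain ⟨x, hx, y, hy, hxy⟩ := h U hU ⟨z, hz⟩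
    rcases split_aux f F hF hFd δ x y z hxy with h | h
    · exact ⟨x, hx, h⟩
    · exact ⟨y, hy, h⟩
  tfae_have 5 → 1 := by
    rintro ⟨δ, hδ, h⟩
    refine ⟨δ, hδ, fun U hU ⟨x, hx⟩ => ?_⟩
    obtain ⟨y, hy, hxy⟩ := h x U hU hx
    exact ⟨x, hx, y, hy, hxy⟩
  tfae_have 1 → 2 := by
    rintro ⟨δ, hδ, h⟩
    refine ⟨δ / 2, by linarith, fun z => ?_⟩
    rw [asym_compl_aux]
    have hG : IsGδ ((fun y : X => (z, y)) ⁻¹'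
        (attachSet (prodSys f) F {p : X × X | δ / 2 < dist p.1 p.2})) :=
      (hop (δ / 2)).preimage (by fun_prop)
    have hD : Dense ((fun y : X => (z, y)) ⁻¹'
        (attachSet (prodSys f) F {p : X × X | δ / 2 < dist p.1 p.2})) := by
      rw [dense_iff_inter_open]
      intro U hU hne
      obtain ⟨x, hx, y, hy, hxy⟩ := h U hU hne
      rcases split_aux f F hF hFd δ x y z hxy with h | h
      · exact ⟨x, hx, (mem_attach_aux f F _ (z, x)).2 h⟩
      · exact ⟨y, hy, (mem_attach_aux f F _ (z, y)).2 h⟩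
    have := residual_of_dense_Gδ hG hD
    unfold IsMeagre
    convert this using 1
    ext y
    simp
  tfae_have 2 → 4 := by
    rintro ⟨δ, hδ, h⟩
    refine ⟨δ, hδ, ?_⟩
    rw [dense_iff_inter_open]
    rintro U hU ⟨⟨a, b⟩, hab⟩
    have hm := h a
    rw [asym_compl_aux] at hm
    have hd := dense_of_mem_residual hm
    obtain ⟨y, hy, hy'⟩ := dense_iff_inter_open.1 hd ((fun y : X => (a, y)) ⁻¹' U)
      (hU.preimage (by fun_prop)) ⟨b, hab⟩
    exact ⟨(a, y), hy, by simpa using hy'⟩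
  tfae_have 4 → 3 := by
    rintro ⟨δ, hδ, h⟩
    refine ⟨δ, hδ, ?_⟩
    rw [asym_compl_aux]
    unfold IsMeagre
    rw [compl_compl]
    exact residual_of_dense_Gδ (hop δ) h
  tfae_have 3 → 4 := by
    rintro ⟨δ, hδ, h⟩
    refine ⟨δ, hδ, ?_⟩
    rw [asym_compl_aux] at h
    unfold IsMeagre at h
    rw [compl_compl] at h
    exact dense_of_mem_residual h
  tfae_have 4 → 1 := by
    rintro ⟨δ, hδ, h⟩
    refine ⟨δ, hδ, fun U hU hne => ?_⟩
    obtain ⟨⟨x, y⟩, ⟨hx, hy⟩, hxy⟩ := dense_iff_inter_open.1 h (U ×ˢ U) (hU.prod hU) (hne.prod hne)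
    exact ⟨x, hx, y, hy, (mem_attach_aux f F _ (x, y)).1 hxy⟩
  tfae_finish
end

section
/- Let (X, f_{1,∞}) be a non-autonomous discrete dynamical system and F a Furstenberg family. If there exists δ > 0 such that Asym_δ(F) is a first category (meagre) subset of X × X, then (X, f_{1,∞}) is weakly F-sensitive. -/
open Set

/-- If `Asym_δ(F)` is meagre in `X × X` for some `δ > 0`, then
`(X, f_{1,∞})` is weakly `F`-sensitive. -/
theorem weaklyFSensitive_of_meagre_asym {X : Type*} [MetricSpace X] [CompactSpace X]
    (f : ℕ → X → X) (hf : ∀ n, Continuous (f n))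
    (F : Set (Set ℕ)) (hF : IsFurstenbergFamily F) :
    (∃ δ > (0 : ℝ), IsMeagre (asymSet f F δ)) → WFSens f F := by
  rintro ⟨δ, hδ, hm⟩
  refine ⟨δ, hδ, fun U hU hne => ?_⟩
  have hd : Dense (asymSet f F δ)ᶜ := dense_of_mem_residual hm
  obtain ⟨p, hpU, hp⟩ := hd.inter_open_nonempty (U ×ˢ U) (hU.prod hU) (hne.prod hne)
  refine ⟨p.1, hpU.1, p.2, hpU.2, ?_⟩
  have h : {n : ℕ | dist (orbitN f n p.1) (orbitN f n p.2) ≤ δ}ᶜ ∈ F := by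
    by_contra hc
    exact hp hc
  refine hF.1 ?_ h
  intro n hn
  simpa using hn
end

section
/- Let (X, f_{1,∞}) be a non-autonomous discrete dynamical system and let F be a Furstenberg family that is filterdual and compatible with the product system (X × X, f_{1,∞} × f_{1,∞}). If (X, f_{1,∞}) is weakly F-sensitive, then there exists δ > 0 such that for every x ∈ X the section Asym_δ(F)(x) is a first category (meagre) subset of X. -/
open Set

/-- For a filterdual `F` compatible with the product system, weak
`F`-sensitivity yields `δ > 0` with every section `Asym_δ(F)(x)` meagre in `X`. -/
theorem meagre_sections_of_weaklyFSensitive {X : Type*} [MetricSpace X] [CompactSpace X]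
    (f : ℕ → X → X) (hf : ∀ n, Continuous (f n))
    (F : Set (Set ℕ)) (hF : IsFurstenbergFamily F) (hFd : IsFilterdual F)
    (hcompat : CompatibleWith (prodSys f) F) :
    WFSens f F →
      ∃ δ > (0 : ℝ), ∀ x : X, IsMeagre {y : X | (x, y) ∈ asymSet f F δ} := by
  rintro ⟨δ, hδ, h⟩
  refine ⟨δ / 2, by positivity, fun x => ?_⟩
  have hopen : IsOpen {p : X × X | δ / 2 < dist p.1 p.2} :=
    isOpen_lt continuous_const continuous_dist
  have heq : {y : X | (x, y) ∈ asymSet f F (δ / 2)}ᶜ =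
      (fun y => (x, y)) ⁻¹' attachSet (prodSys f) F {p : X × X | δ / 2 < dist p.1 p.2} := by
    ext y
    simp [asymSet, dualFam, attachSet, orbitN_prodSys_aux, Set.compl_setOf]
  have hG : IsGδ {y : X | (x, y) ∈ asymSet f F (δ / 2)}ᶜ := by
    rw [heq]
    obtain ⟨T, hT, hTc, hTe⟩ := hcompat _ hopen
    rw [hTe, Set.preimage_sInter]
    exact IsGδ.biInter_of_isOpen hTc
      (fun t ht => (hT t ht).preimage (by fun_prop))
  have hD : Dense {y : X | (x, y) ∈ asymSet f F (δ / 2)}ᶜ := by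
    rw [dense_iff_inter_open]
    intro U hU hne
    obtain ⟨y, hy, z, hz, hyz⟩ := h U hU hne
    by_contra hcon
    have key : ∀ w ∈ U, (x, w) ∈ asymSet f F (δ / 2) := fun w hw => by
      by_contra h'
      exact hcon ⟨w, hw, h'⟩
    have h3 := hFd (key y hy) (key z hz)
    refine h3 (hF.1 ?_ hyz)
    rintro n hn ⟨h1, h2⟩
    simp only [Set.mem_setOf_eq] at hn h1 h2
    have := dist_triangle_left (orbitN f n y) (orbitN f n z) (orbitN f n x)
    linarith
  exact residual_of_dense_Gδ hG hD
end

section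
/- Let (X, f_{1,∞}) be a non-autonomous discrete dynamical system and let F be a Furstenberg family compatible with the product system (X × X, f_{1,∞} × f_{1,∞}). If there exists δ > 0 such that for every x ∈ X the section Asym_δ(F)(x) is a first category (meagre) subset of X, then Asym_δ(F) is a first category (meagre) subset of X × X. -/
open Set

/-- For `F` compatible with the product system: if `δ > 0` is such that
every section `Asym_δ(F)(x)` is meagre in `X`, then `Asym_δ(F)` is meagre in `X × X`. -/
theorem meagre_asym_of_meagre_sections {X : Type*} [MetricSpace X] [CompactSpace X]
    (f : ℕ → X → X) (hf : ∀ n, Continuous (f n))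
    (F : Set (Set ℕ)) (hF : IsFurstenbergFamily F)
    (hcompat : CompatibleWith (prodSys f) F) :
    ∀ δ : ℝ, 0 < δ →
      (∀ x : X, IsMeagre {y : X | (x, y) ∈ asymSet f F δ}) →
      IsMeagre (asymSet f F δ) := by
  intro δ hδ hsec
  have horb : ∀ (n : ℕ) (p : X × X),
      orbitN (prodSys f) n p = (orbitN f n p.1, orbitN f n p.2) := by
    intro n p
    induction n with
    | zero => rfl
    | succ k ih =>
      simp only [orbitN, Function.comp_apply]
      rw [ih]
      rfl
  have hU : IsOpen {p : X × X | δ < dist p.1 p.2} :=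
    isOpen_lt continuous_const continuous_dist
  have hG := hcompat _ hU
  have heq : (asymSet f F δ)ᶜ = attachSet (prodSys f) F {p : X × X | δ < dist p.1 p.2} := by
    ext p
    simp [asymSet, attachSet, dualFam, horb, Set.compl_setOf]
  rw [← heq] at hG
  have hd : Dense (asymSet f F δ)ᶜ := by
    rintro ⟨x, y⟩
    rw [mem_closure_iff_nhds]
    intro t ht
    rw [nhds_prod_eq, Filter.mem_prod_iff] at ht
    obtain ⟨A, hA, B, hB, hAB⟩ := ht
    have hdense : Dense {y : X | (x, y) ∈ asymSet f F δ}ᶜ := dense_of_mem_residual (hsec x)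
    obtain ⟨z, hzB, hz⟩ := mem_closure_iff_nhds.1 (hdense y) B hB
    exact ⟨(x, z), hAB ⟨mem_of_mem_nhds hA, hzB⟩, hz⟩
  exact residual_of_dense_Gδ hG hd
end

section
/- Let (X, f_{1,∞}) be a non-autonomous discrete dynamical system generated by a family f_{1,∞} of feeble open maps each of which commutes with a continuous map f : X → X, and let F be a filterdual, translation invariant Furstenberg family. If Σ_{i=1}^∞ D(f_i, f) < ∞ and the autonomous system (X, f) is F-sensitive, then (X, f_{1,∞}) is F-sensitive. -/
open Set

theorem aux_orbit_add {X : Type*} (f : ℕ → X → X) (m n : ℕ) (x : X) :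
    orbitN f (n + m) x = orbitN (fun i => f (i + m)) n (orbitN f m x) := by
  induction n with
  | zero => simp [orbitN]
  | succ k ih =>
    rw [show k + 1 + m = (k + m) + 1 by omega]
    simp only [orbitN, Function.comp_apply, ih]

theorem aux_orbit_comm {X : Type*} (f : ℕ → X → X) (g : X → X)
    (hcomm : ∀ n, f n ∘ g = g ∘ f n) (n : ℕ) (x : X) :
    orbitN f n (g x) = g (orbitN f n x) := by
  induction n with
  | zero => simp [orbitN]
  | succ k ih =>
    simp only [orbitN, Function.comp_apply, ih]
    exact congrFun (hcomm k) _

theorem aux_dist {X : Type*} [MetricSpace X] (f : ℕ → X → X) (g : X → X)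
    (hcomm : ∀ n, f n ∘ g = g ∘ f n) (D : ℕ → ℝ) (hD : ∀ n x, dist (f n x) (g x) ≤ D n)
    (n : ℕ) : ∀ x : X,
    dist (orbitN f n x) (orbitN (fun _ => g) n x) ≤ ∑ i ∈ Finset.range n, D i := by
  induction n with
  | zero => intro x; simp [orbitN]
  | succ k ih =>
    intro x
    have h1 := hD k (orbitN f k x)
    have h2 := ih (g x)
    rw [aux_orbit_comm f g hcomm, aux_orbit_comm (fun _ => g) g (fun _ => rfl)] at h2
    rw [Finset.sum_range_succ]
    simp only [orbitN, Function.comp_apply]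
    linarith [dist_triangle (f k (orbitN f k x)) (g (orbitN f k x))
      (g (orbitN (fun _ => g) k x))]

theorem aux_feeble {X : Type*} [MetricSpace X] (f : ℕ → X → X)
    (hfeeble : ∀ n, ∀ U : Set X, IsOpen U → U.Nonempty → (interior (f n '' U)).Nonempty)
    (U : Set X) (hU : IsOpen U) (hn : U.Nonempty) (n : ℕ) :
    (interior (orbitN f n '' U)).Nonempty := by
  induction n with
  | zero => simpa [orbitN, hU.interior_eq] using hn
  | succ k ih =>
    refine (hfeeble k _ isOpen_interior ih).mono (interior_mono ?_)
    simp only [orbitN, image_comp]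
    exact image_mono interior_subset

/-- Let `(X, f_{1,∞})` consist of feeble open maps commuting with `f`,
let `F` be a filterdual, translation invariant Furstenberg family, and suppose
`Σ_{i=1}^∞ D(f_i, f) < ∞`. If `(X, f)` is `F`-sensitive, then so is `(X, f_{1,∞})`. -/
theorem fSensitive_of_limit_fSensitive {X : Type*} [MetricSpace X] [CompactSpace X]
    (f : ℕ → X → X) (hf : ∀ n, Continuous (f n))
    (g : X → X) (hg : Continuous g)
    (hfeeble : ∀ n, ∀ U : Set X, IsOpen U → U.Nonempty → (interior (f n '' U)).Nonempty)
    (hcomm : ∀ n, f n ∘ g = g ∘ f n)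
    (F : Set (Set ℕ)) (hF : IsFurstenbergFamily F) (hFd : IsFilterdual F) (hTI : TransInv F)
    (hsum : Summable fun i => ⨆ x : X, dist (f i x) (g x)) :
    FSens (fun _ => g) F → FSens f F := by
  rintro ⟨δ, hδ, hs⟩
  set D : ℕ → ℝ := fun i => ⨆ x : X, dist (f i x) (g x) with hDdef
  have hD : ∀ n x, dist (f n x) (g x) ≤ D n := fun n x =>
    le_ciSup (f := fun x => dist (f n x) (g x))
      (isCompact_range ((hf n).dist hg)).bddAbove x
  have hD0 : ∀ n, 0 ≤ D n := fun n => Real.iSup_nonneg fun x => dist_nonneg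
  obtain ⟨m, hm⟩ := ((tendsto_sum_nat_add D).eventually
    (gt_mem_nhds (show (0 : ℝ) < δ / 8 by linarith))).exists
  have hb : ∀ n x, dist (orbitN (fun i => f (i + m)) n x) (orbitN (fun _ => g) n x) ≤ δ / 8 := by
    intro n x
    refine (aux_dist (fun i => f (i + m)) g (fun i => hcomm _) (fun i => D (i + m))
      (fun i => hD _) n x).trans (le_trans ?_ hm.le)
    exact ((summable_nat_add_iff m).2 hsum).sum_le_tsum _ (fun i _ => hD0 _)
  refine ⟨δ / 4, by linarith, fun x U hU hx => ?_⟩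
  obtain ⟨v, hv⟩ := aux_feeble f hfeeble U hU ⟨x, hx⟩ m
  obtain ⟨y, hy, hA⟩ := hs v _ isOpen_interior hv
  obtain ⟨u, hu, rfl⟩ := interior_subset hv
  obtain ⟨w, hw, rfl⟩ := interior_subset hy
  by_contra hcon
  push Not at hcon
  have h1 := hcon u hu
  have h2 := hcon w hw
  have h3 := @hFd {n : ℕ | δ / 4 < dist (orbitN f n x) (orbitN f n u)}ᶜ
    {n : ℕ | δ / 4 < dist (orbitN f n x) (orbitN f n w)}ᶜ
    (by simpa [dualFam] using h1) (by simpa [dualFam] using h2)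
  apply h3
  refine hF.1 ?_ (hTI _ hA m).1
  rintro _ ⟨n, hn, rfl⟩ ⟨ha, hc⟩
  simp only [mem_compl_iff, mem_setOf_eq, not_lt] at hn ha hc
  rw [aux_orbit_add f m n u] at ha
  rw [aux_orbit_add f m n w] at hc
  have e1 := hb n (orbitN f m u)
  have e2 := hb n (orbitN f m w)
  rw [dist_comm] at e1 ha
  have t1 := dist_triangle4 (orbitN (fun _ => g) n (orbitN f m u))
    (orbitN (fun i => f (i + m)) n (orbitN f m u))
    (orbitN (fun i => f (i + m)) n (orbitN f m w)) (orbitN (fun _ => g) n (orbitN f m w))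
  have t2 := dist_triangle (orbitN (fun i => f (i + m)) n (orbitN f m u))
    (orbitN f (n + m) x) (orbitN (fun i => f (i + m)) n (orbitN f m w))
  linarith
end

section
/- Let (X, f_{1,∞}) be a non-autonomous discrete dynamical system generated by a family f_{1,∞} of feeble open maps each of which commutes with a continuous map f : X → X, and let F be a filterdual, translation invariant Furstenberg family. If Σ_{i=1}^∞ D(f_i, f) < ∞ and (X, f_{1,∞}) is F-sensitive, then the autonomous system (X, f) is F-sensitive. -/
open Set

theorem orbitN_comm_aux {X : Type*} (h : ℕ → X → X) (g : X → X)
    (hc : ∀ n x, h n (g x) = g (h n x)) (n : ℕ) (x : X) :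
    orbitN h n (g x) = g (orbitN h n x) := by
  induction n with
  | zero => rfl
  | succ n ih =>
    change h n (orbitN h n (g x)) = g (h n (orbitN h n x))
    rw [ih, hc]

theorem orbitN_const_comm_aux {X : Type*} (h : X → X) (g : X → X)
    (hc : ∀ x, h (g x) = g (h x)) (n : ℕ) (x : X) :
    orbitN (fun _ => g) n (h x) = h (orbitN (fun _ => g) n x) :=
  orbitN_comm_aux (fun _ => g) h (fun _ x => (hc x).symm) n x

theorem orbitN_add_aux {X : Type*} (f : ℕ → X → X) (k n : ℕ) (x : X) :
    orbitN f (n + k) x = orbitN (fun i => f (i + k)) n (orbitN f k x) := by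
  induction n with
  | zero => simp [orbitN]
  | succ n ih =>
    rw [Nat.add_right_comm]
    change f (n + k) (orbitN f (n + k) x) = f (n + k) (orbitN (fun i => f (i + k)) n (orbitN f k x))
    rw [ih]

theorem orbitN_dist_aux {X : Type*} [MetricSpace X] (h : ℕ → X → X) (g : X → X)
    (hc : ∀ n x, h n (g x) = g (h n x)) (D : ℕ → ℝ)
    (hD : ∀ n x, dist (h n x) (g x) ≤ D n) (n : ℕ) (x : X) :
    dist (orbitN h n x) (orbitN (fun _ => g) n x) ≤ ∑ i ∈ Finset.range n, D i := by
  induction n generalizing x with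
  | zero => simp [orbitN]
  | succ n ih =>
    have h1 := ih (g x)
    rw [orbitN_comm_aux h g hc, orbitN_const_comm_aux g g (fun _ => rfl)] at h1
    have h2 := hD n (orbitN h n x)
    rw [Finset.sum_range_succ]
    change dist (h n (orbitN h n x)) (g (orbitN (fun _ => g) n x)) ≤ _
    linarith [dist_triangle (h n (orbitN h n x)) (g (orbitN h n x)) (g (orbitN (fun _ => g) n x))]

theorem orbitN_continuous_aux {X : Type*} [TopologicalSpace X] (f : ℕ → X → X)
    (hf : ∀ n, Continuous (f n)) (n : ℕ) : Continuous (orbitN f n) := by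
  induction n with
  | zero => exact continuous_id
  | succ n ih => exact (hf n).comp ih

/-- Let `(X, f_{1,∞})` consist of feeble open maps commuting with `f`,
let `F` be a filterdual, translation invariant Furstenberg family, and suppose
`Σ_{i=1}^∞ D(f_i, f) < ∞`. If `(X, f_{1,∞})` is `F`-sensitive, then so is `(X, f)`. -/
theorem limit_fSensitive_of_fSensitive {X : Type*} [MetricSpace X] [CompactSpace X]
    (f : ℕ → X → X) (hf : ∀ n, Continuous (f n))
    (g : X → X) (hg : Continuous g)
    (hfeeble : ∀ n, ∀ U : Set X, IsOpen U → U.Nonempty → (interior (f n '' U)).Nonempty)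
    (hcomm : ∀ n, f n ∘ g = g ∘ f n)
    (F : Set (Set ℕ)) (hF : IsFurstenbergFamily F) (hFd : IsFilterdual F) (hTI : TransInv F)
    (hsum : Summable fun i => ⨆ x : X, dist (f i x) (g x)) :
    FSens f F → FSens (fun _ => g) F := by
  rintro ⟨δ, hδ, hs⟩
  have hc : ∀ n x, f n (g x) = g (f n x) := fun n x => congrFun (hcomm n) x
  set D : ℕ → ℝ := fun i => ⨆ x : X, dist (f i x) (g x) with hDdef
  have hD : ∀ n x, dist (f n x) (g x) ≤ D n := fun n x =>
    le_ciSup (f := fun x => dist (f n x) (g x))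
      (isCompact_range ((hf n).dist hg)).bddAbove x
  have hD0 : ∀ n, 0 ≤ D n := fun n => Real.iSup_nonneg fun x => dist_nonneg
  obtain ⟨k, hk⟩ := ((tendsto_sum_nat_add D).eventually_lt_const
    (show (0 : ℝ) < δ / 4 by positivity)).exists
  have hsk : Summable fun i => D (i + k) := (summable_nat_add_iff k).2 hsum
  have hclose : ∀ n z, dist (orbitN (fun i => f (i + k)) n z) (orbitN (fun _ => g) n z) < δ / 4 := by
    intro n z
    refine lt_of_le_of_lt (orbitN_dist_aux (fun i => f (i + k)) g (fun n x => hc _ x)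
      (fun i => D (i + k)) (fun n x => hD _ x) n z) (lt_of_le_of_lt ?_ hk)
    exact hsk.sum_le_tsum _ (fun i _ => hD0 _)
  have huc := CompactSpace.uniformContinuous_of_continuous (orbitN_continuous_aux f hf k)
  obtain ⟨η, hη, hu⟩ := Metric.uniformContinuous_iff.1 huc (δ / 2) (by positivity)
  refine ⟨η / 2, by positivity, fun x U hU hx => ?_⟩
  obtain ⟨y, hy, hA⟩ := hs x U hU hx
  refine ⟨y, hy, hF.1 ?_ ((hTI _ hA k).2)⟩
  intro n hn
  change δ < dist (orbitN f (n + k) x) (orbitN f (n + k) y) at hn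
  change η / 2 < dist (orbitN (fun _ => g) n x) (orbitN (fun _ => g) n y)
  by_contra hcon
  have h1 := hu (lt_of_le_of_lt (not_lt.1 hcon) (by linarith))
  have hck := orbitN_comm_aux f g hc k
  rw [← orbitN_const_comm_aux _ g hck, ← orbitN_const_comm_aux _ g hck] at h1
  rw [orbitN_add_aux, orbitN_add_aux] at hn
  have h2 := hclose n (orbitN f k x)
  have h3 := hclose n (orbitN f k y)
  rw [dist_comm] at h3
  have h4 := dist_triangle4 (orbitN (fun i => f (i + k)) n (orbitN f k x))
    (orbitN (fun _ => g) n (orbitN f k x)) (orbitN (fun _ => g) n (orbitN f k y))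
    (orbitN (fun i => f (i + k)) n (orbitN f k y))
  linarith
end
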